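/- Let δ ≥ 1 and let H be a proper δ-hyperbolic Busemann space with fixed base point w ∈ H and boundary point a ∈ ∂H. Let x, y ∈ H, let V_x and V_y be vertical geodesics through x and y parametrised so that h(V_x(t)) = t and h(V_y(t)) = t, let t₀ ≥ max(h(x), h(y)), and set x₀ = V_x(t₀), y₀ = V_y(t₀). Assume d(x₀, y₀) > 768δ. Then every connected path γ : [0,T] → H with γ(0) = x, γ(T) = y and h⁺(γ) ≤ h(x₀) satisfies l(γ) ≥ Δh(x, x₀) + Δh(y, y₀) + 2^{−386}·2^{d(x₀,y₀)/(2δ)} − 24δ. -/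

import Mathlib

open Set Filter
open scoped ENNReal NNReal

noncomputable section

namespace HP

variable {H : Type*} [MetricSpace H]

/-- `γ` restricted to `I` is an arclength-parametrised (isometric) geodesic. -/
def IsGeodesicOn (γ : ℝ → H) (I : Set ℝ) : Prop :=
  ∀ s ∈ I, ∀ t ∈ I, dist (γ s) (γ t) = |s - t|

/-- A geodesic line of `H`. -/
def IsGeodesicLine (γ : ℝ → H) : Prop := IsGeodesicOn γ Set.univ

/-- A geodesic ray of `H`, parametrised on `[0,∞)`. -/
def IsGeodesicRay (γ : ℝ → H) : Prop := IsGeodesicOn γ (Set.Ici 0)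

/-- A geodesic ray starting at `w`. -/
def IsRayFrom (w : H) (γ : ℝ → H) : Prop := IsGeodesicRay γ ∧ γ 0 = w

/-- A geodesic segment from `x` to `y`, parametrised on `[0, dist x y]`. -/
def IsGeodSegment (γ : ℝ → H) (x y : H) : Prop :=
  IsGeodesicOn γ (Set.Icc 0 (dist x y)) ∧ γ 0 = x ∧ γ (dist x y) = y

/-- The traces on `[0,∞)` of two rays are at finite Hausdorff distance. -/
def FinHausRays (γ₁ γ₂ : ℝ → H) : Prop :=
  ∃ C : ℝ, (∀ s : ℝ, 0 ≤ s → ∃ t : ℝ, 0 ≤ t ∧ dist (γ₁ s) (γ₂ t) ≤ C) ∧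
           (∀ t : ℝ, 0 ≤ t → ∃ s : ℝ, 0 ≤ s ∧ dist (γ₁ s) (γ₂ t) ≤ C)

/-- A geodesic metric space: any two points are joined by a geodesic segment. -/
def GeodesicSpace (H : Type*) [MetricSpace H] : Prop :=
  ∀ x y : H, ∃ γ : ℝ → H, IsGeodSegment γ x y

/-- `δ`-hyperbolicity: geodesic space all of whose geodesic triangles are `δ`-slim,
i.e. each side is contained in the `δ`-neighbourhood of the union of the other two. -/
def DeltaHyperbolic (H : Type*) [MetricSpace H] (δ : ℝ) : Prop :=
  GeodesicSpace H ∧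
  ∀ x y z : H, ∀ γ₁ γ₂ γ₃ : ℝ → H,
    IsGeodSegment γ₁ x y → IsGeodSegment γ₂ y z → IsGeodSegment γ₃ z x →
    ∀ s ∈ Set.Icc (0:ℝ) (dist x y),
      ∃ u ∈ γ₂ '' Set.Icc (0:ℝ) (dist y z) ∪ γ₃ '' Set.Icc (0:ℝ) (dist z x),
        dist (γ₁ s) u ≤ δ

/-- A Busemann space: geodesic, and the distance between any two
arclength-parametrised geodesics is a convex function. -/
def BusemannSpace (H : Type*) [MetricSpace H] : Prop :=
  GeodesicSpace H ∧
  ∀ (a b a' b' : ℝ) (γ γ' : ℝ → H),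
    IsGeodesicOn γ (Set.Icc a b) → IsGeodesicOn γ' (Set.Icc a' b') →
    ConvexOn ℝ (Set.Icc a b ×ˢ Set.Icc a' b')
      (fun p : ℝ × ℝ => dist (γ p.1) (γ' p.2))

/-- Geodesic completeness: every geodesic segment extends to a geodesic line. -/
def GeodesicallyComplete (H : Type*) [MetricSpace H] : Prop :=
  ∀ (a b : ℝ) (γ : ℝ → H), a ≤ b → IsGeodesicOn γ (Set.Icc a b) →
    ∃ γ' : ℝ → H, IsGeodesicLine γ' ∧ ∀ t ∈ Set.Icc a b, γ' t = γ t

/-- The Busemann function with respect to the boundary point represented by the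
geodesic ray `aRep` and the base point `w`. -/
def busemann (w : H) (aRep : ℝ → H) (x : H) : ℝ :=
  sSup { b : ℝ | ∃ k : ℝ → H, IsRayFrom w k ∧ FinHausRays aRep k ∧
    b = Filter.limsup (fun t => dist x (k t) - t) Filter.atTop }

/-- The height function: minus the Busemann function. -/
def height (w : H) (aRep : ℝ → H) (x : H) : ℝ := - busemann w aRep x

/-- A vertical geodesic (forward oriented): a geodesic line whose height tends to `+∞`. -/
def IsVerticalGeodesic (w : H) (aRep : ℝ → H) (V : ℝ → H) : Prop :=
  IsGeodesicLine V ∧ Tendsto (fun t => height w aRep (V t)) atTop atTop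

/-- A vertical geodesic line (either orientation): a geodesic line whose image lies
in the boundary class, i.e. whose height tends to `+∞` along one of its ends. -/
def IsVerticalGeodesicLine (w : H) (aRep : ℝ → H) (V : ℝ → H) : Prop :=
  IsGeodesicLine V ∧
    (Tendsto (fun t => height w aRep (V t)) atTop atTop ∨
     Tendsto (fun t => height w aRep (V t)) atBot atTop)

/-- A vertical geodesic parametrised by its height: `h(V(t)) = t` for all `t`. -/
def VertParam (w : H) (aRep : ℝ → H) (V : ℝ → H) : Prop :=
  IsGeodesicLine V ∧ ∀ t : ℝ, height w aRep (V t) = t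

/-- Height difference `Δh(x,y)`. -/
def dh (w : H) (aRep : ℝ → H) (x y : H) : ℝ :=
  |height w aRep x - height w aRep y|

/-- Relative distance `d_r(x,y) = d(x,y) - Δh(x,y)`. -/
def dr (w : H) (aRep : ℝ → H) (x y : H) : ℝ := dist x y - dh w aRep x y

/-- Maximal height `h⁺` of a path along the parameter set `I`. -/
def hplusOn (w : H) (aRep : ℝ → H) (γ : ℝ → H) (I : Set ℝ) : ℝ :=
  sSup ((fun t => height w aRep (γ t)) '' I)

/-- Minimal height `h⁻` of a path along the parameter set `I`. -/
def hminusOn (w : H) (aRep : ℝ → H) (γ : ℝ → H) (I : Set ℝ) : ℝ :=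
  sInf ((fun t => height w aRep (γ t)) '' I)

/-- A path parametrised by arclength: the length of the piece on `[s,t]` equals `t - s`. -/
def ArclengthPath (V : ℝ → H) : Prop :=
  ∀ s t : ℝ, s ≤ t → eVariationOn V (Set.Icc s t) = ENNReal.ofReal (t - s)

/-- An admissible norm on `ℝ²`: a norm with `N(1,1) = 1` and `N(a,b) ≥ (a+b)/2`. -/
structure AdmNorm where
  toFun : ℝ × ℝ → ℝ
  eq_zero_iff : ∀ v : ℝ × ℝ, toFun v = 0 ↔ v = 0
  smul_eq : ∀ (c : ℝ) (v : ℝ × ℝ), toFun (c • v) = |c| * toFun v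
  add_le : ∀ v w : ℝ × ℝ, toFun (v + w) ≤ toFun v + toFun w
  one_one : toFun (1, 1) = 1
  adm : ∀ a b : ℝ, (a + b) / 2 ≤ toFun (a, b)

/-- `C` is a comparison constant `C_N` for the admissible norm `N`:
`C ≥ 1` and `N(a,b) ≤ C(a+b)/2` for all `a,b ≥ 0`. -/
def AdmNorm.BoundConst (N : AdmNorm) (C : ℝ) : Prop :=
  1 ≤ C ∧ ∀ a b : ℝ, 0 ≤ a → 0 ≤ b → N.toFun (a, b) ≤ C * (a + b) / 2

variable {Hp Hq : Type*} [MetricSpace Hp] [MetricSpace Hq]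

/-- Membership in the horospherical product: `h_p(x_p) + h_q(x_q) = 0`. -/
def inHoro (wp : Hp) (ap : ℝ → Hp) (wq : Hq) (aq : ℝ → Hq) (z : Hp × Hq) : Prop :=
  height wp ap z.1 + height wq aq z.2 = 0

/-- The `N`-length of a path in `Hp × Hq`: supremum over finite monotone
subdivisions of the sums of the `N(d_p, d_q)`-distances. -/
def lN (Nf : ℝ × ℝ → ℝ) (γ : ℝ → Hp × Hq) (s : Set ℝ) : ℝ≥0∞ :=
  ⨆ p : ℕ × { u : ℕ → ℝ // Monotone u ∧ ∀ i, u i ∈ s },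
    ∑ i ∈ Finset.range p.1,
      ENNReal.ofReal (Nf (dist (γ (p.2.1 (i+1))).1 (γ (p.2.1 i)).1,
                          dist (γ (p.2.1 (i+1))).2 (γ (p.2.1 i)).2))

/-- The `N`-path metric: infimum of `N`-lengths of connected paths staying in the
horospherical product and joining the two points. -/
def dHN (Nf : ℝ × ℝ → ℝ) (mem : Hp × Hq → Prop) (x y : Hp × Hq) : ℝ≥0∞ :=
  ⨅ (T : ℝ) (_ : 0 ≤ T) (γ : ℝ → Hp × Hq) (_ : ContinuousOn γ (Set.Icc 0 T))
    (_ : ∀ t ∈ Set.Icc (0:ℝ) T, mem (γ t)) (_ : γ 0 = x) (_ : γ T = y),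
    lN Nf γ (Set.Icc 0 T)

/-- A geodesic of the horospherical product with respect to the `N`-path metric,
parametrised (by arclength) on `I` and staying in the product. -/
def IsHNGeodesicOn (Nf : ℝ × ℝ → ℝ) (mem : Hp × Hq → Prop)
    (α : ℝ → Hp × Hq) (I : Set ℝ) : Prop :=
  (∀ t ∈ I, mem (α t)) ∧
  ∀ s ∈ I, ∀ t ∈ I, dHN Nf mem (α s) (α t) = ENNReal.ofReal |s - t|

/-- A vertical geodesic of the horospherical product, parametrised by its height. -/
def IsHNVerticalLine (Nf : ℝ × ℝ → ℝ) (mem : Hp × Hq → Prop)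
    (wp : Hp) (ap : ℝ → Hp) (V : ℝ → Hp × Hq) : Prop :=
  IsHNGeodesicOn Nf mem V Set.univ ∧ ∀ t : ℝ, height wp ap (V t).1 = t

/-- Maximal height `h⁺` of a path of the horospherical product. -/
def hplusH (wp : Hp) (ap : ℝ → Hp) (γ : ℝ → Hp × Hq) (I : Set ℝ) : ℝ :=
  sSup ((fun t => height wp ap (γ t).1) '' I)

/-- Minimal height `h⁻` of a path of the horospherical product. -/
def hminusH (wp : Hp) (ap : ℝ → Hp) (γ : ℝ → Hp × Hq) (I : Set ℝ) : ℝ :=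
  sInf ((fun t => height wp ap (γ t).1) '' I)

/-- `H_p`-type path at scale `κ`: the first component stays `κ`-close to a geodesic
of `H_p` and the second component stays `κ`-close to a vertical geodesic of `H_q`. -/
def IsHpType (wq : Hq) (aq : ℝ → Hq) (κ : ℝ) (α : ℝ → Hp × Hq) : Prop :=
  (∃ g : ℝ → Hp, IsGeodesicLine g ∧ ∀ t : ℝ, ∃ s : ℝ, dist (α t).1 (g s) ≤ κ) ∧
  (∃ v : ℝ → Hq, IsVerticalGeodesicLine wq aq v ∧ ∀ t : ℝ, ∃ s : ℝ, dist (α t).2 (v s) ≤ κ)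

/-- `H_q`-type path at scale `κ`. -/
def IsHqType (wp : Hp) (ap : ℝ → Hp) (κ : ℝ) (α : ℝ → Hp × Hq) : Prop :=
  (∃ g : ℝ → Hq, IsGeodesicLine g ∧ ∀ t : ℝ, ∃ s : ℝ, dist (α t).2 (g s) ≤ κ) ∧
  (∃ v : ℝ → Hp, IsVerticalGeodesicLine wp ap v ∧ ∀ t : ℝ, ∃ s : ℝ, dist (α t).1 (v s) ≤ κ)

/-- Finite Hausdorff distance on `[0,∞)` between two rays, for a generalized
(`ℝ≥0∞`-valued) distance `dd`. -/
def HNFinHaus {X : Type*} (dd : X → X → ℝ≥0∞) (α β : ℝ → X) : Prop :=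
  ∃ C : ℝ, (∀ s : ℝ, 0 ≤ s → ∃ t : ℝ, 0 ≤ t ∧ dd (α s) (β t) ≤ ENNReal.ofReal C) ∧
           (∀ t : ℝ, 0 ≤ t → ∃ s : ℝ, 0 ≤ s ∧ dd (α s) (β t) ≤ ENNReal.ofReal C)

theorem finHaus_equivalence (H : Type*) [MetricSpace H] :
    Equivalence (fun γ₁ γ₂ : {γ : ℝ → H // IsGeodesicRay γ} => FinHausRays γ₁.1 γ₂.1) := by
  constructor
  · intro γ
    exact ⟨0, fun s hs => ⟨s, hs, by simp⟩, fun t ht => ⟨t, ht, by simp⟩⟩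
  · rintro γ₁ γ₂ ⟨C, h1, h2⟩
    refine ⟨C, fun s hs => ?_, fun t ht => ?_⟩
    · obtain ⟨u, hu, hd⟩ := h2 s hs
      exact ⟨u, hu, by rwa [dist_comm]⟩
    · obtain ⟨u, hu, hd⟩ := h1 t ht
      exact ⟨u, hu, by rwa [dist_comm]⟩
  · rintro γ₁ γ₂ γ₃ ⟨C, h1, h2⟩ ⟨D, g1, g2⟩
    refine ⟨C + D, fun s hs => ?_, fun t ht => ?_⟩
    · obtain ⟨u, hu, hd⟩ := h1 s hs
      obtain ⟨v, hv, he⟩ := g1 u hu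
      exact ⟨v, hv, (dist_triangle _ (γ₂.1 u) _).trans (add_le_add hd he)⟩
    · obtain ⟨u, hu, hd⟩ := g2 t ht
      obtain ⟨v, hv, he⟩ := h2 u hu
      exact ⟨v, hv, (dist_triangle _ (γ₂.1 u) _).trans (add_le_add he hd)⟩

/-- The setoid of geodesic rays up to finite Hausdorff distance. -/
instance raySetoid (H : Type*) [MetricSpace H] : Setoid {γ : ℝ → H // IsGeodesicRay γ} :=
  ⟨fun γ₁ γ₂ => FinHausRays γ₁.1 γ₂.1, finHaus_equivalence H⟩

/-- The Gromov boundary: equivalence classes of geodesic rays at finite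
Hausdorff distance. -/
abbrev Bdry (H : Type*) [MetricSpace H] := Quotient (raySetoid H)

/-- The boundary point determined by a geodesic ray. -/
def bdryPt {H : Type*} [MetricSpace H] (γ : ℝ → H) (h : IsGeodesicRay γ) : Bdry H :=
  Quotient.mk (raySetoid H) ⟨γ, h⟩

/-- The set `((∂H_p ∖ {a_p}) × {a_q}) ∪ ({a_p} × (∂H_q ∖ {a_q}))`. -/
def bdryTarget {Hp Hq : Type*} [MetricSpace Hp] [MetricSpace Hq]
    (ap : ℝ → Hp) (hap : IsGeodesicRay ap)
    (aq : ℝ → Hq) (haq : IsGeodesicRay aq) : Set (Bdry Hp × Bdry Hq) :=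
  ((({bdryPt ap hap} : Set (Bdry Hp))ᶜ ×ˢ ({bdryPt aq haq} : Set (Bdry Hq))) ∪
   (({bdryPt ap hap} : Set (Bdry Hp)) ×ˢ ({bdryPt aq haq} : Set (Bdry Hq))ᶜ))

/-! ### Metric betweenness and geodesics -/

/-- The point `m` lies metrically between `x` and `y`. -/
def Btw (x m y : H) : Prop := dist x m + dist m y = dist x y

lemma Btw.symm {x m y : H} (h : Btw x m y) : Btw y m x := by
  unfold Btw at *
  rw [dist_comm y m, dist_comm m x, dist_comm y x]; linarith

lemma IsGeodesicOn.mono {γ : ℝ → H} {I J : Set ℝ} (h : IsGeodesicOn γ J) (hIJ : I ⊆ J) :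
    IsGeodesicOn γ I :=
  fun s hs t ht => h s (hIJ hs) t (hIJ ht)

lemma IsGeodesicOn.continuousOn {γ : ℝ → H} {I : Set ℝ} (h : IsGeodesicOn γ I) :
    ContinuousOn γ I := by
  refine LipschitzOnWith.continuousOn (K := 1) (LipschitzOnWith.of_dist_le_mul ?_)
  intro s hs t ht
  rw [h s hs t ht, Real.dist_eq]; simp

lemma IsGeodSegment.dist_left {γ : ℝ → H} {x y : H} (h : IsGeodSegment γ x y) {s : ℝ}
    (hs : s ∈ Icc 0 (dist x y)) : dist x (γ s) = s := by
  have := h.1 0 ⟨le_rfl, dist_nonneg⟩ s hs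
  rw [h.2.1, zero_sub, abs_neg, abs_of_nonneg hs.1] at this
  exact this

lemma IsGeodSegment.dist_right {γ : ℝ → H} {x y : H} (h : IsGeodSegment γ x y) {s : ℝ}
    (hs : s ∈ Icc 0 (dist x y)) : dist (γ s) y = dist x y - s := by
  have := h.1 s hs (dist x y) ⟨dist_nonneg, le_rfl⟩
  rw [h.2.2, abs_sub_comm, abs_of_nonneg (sub_nonneg.2 hs.2)] at this
  exact this

lemma IsGeodSegment.btw {γ : ℝ → H} {x y : H} (h : IsGeodSegment γ x y) {s : ℝ}
    (hs : s ∈ Icc 0 (dist x y)) : Btw x (γ s) y := by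
  unfold Btw
  rw [h.dist_left hs, h.dist_right hs]; ring

/-- A point metrically between `x` and `y` lies on some geodesic segment from `x` to `y`. -/
lemma Btw.exists_segment (hG : GeodesicSpace H) {x m y : H} (h : Btw x m y) :
    ∃ γ : ℝ → H, IsGeodSegment γ x y ∧ γ (dist x m) = m := by
  obtain ⟨γ₁, h₁⟩ := hG x m
  obtain ⟨γ₂, h₂⟩ := hG m y
  set d := dist x m with hd
  have hxy : d + dist m y = dist x y := h
  have hd0 : 0 ≤ d := dist_nonneg
  have he0 : 0 ≤ dist m y := dist_nonneg
  let γ : ℝ → H := fun t => if t ≤ d then γ₁ t else γ₂ (t - d)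
  have hlow : ∀ t, t ≤ d → γ t = γ₁ t := fun t ht => if_pos ht
  have hhigh : ∀ t, d ≤ t → γ t = γ₂ (t - d) := by
    intro t ht
    rcases ht.lt_or_eq with h' | rfl
    · exact if_neg (not_le.2 h')
    · rw [hlow _ le_rfl, sub_self, h₂.2.1, h₁.2.2]
  have key : ∀ s ∈ Icc 0 (dist x y), ∀ t ∈ Icc 0 (dist x y), s ≤ t →
      dist (γ s) (γ t) = t - s := by
    intro s hs t ht hst
    rcases le_total t d with htd | htd
    · rw [hlow t htd, hlow s (hst.trans htd), h₁.1 s ⟨hs.1, hst.trans htd⟩ t ⟨ht.1, htd⟩,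
        abs_sub_comm, abs_of_nonneg (sub_nonneg.2 hst)]
    have ht' : t - d ∈ Icc 0 (dist m y) := ⟨by linarith, by linarith [ht.2]⟩
    rcases le_total d s with hds | hds
    · rw [hhigh t htd, hhigh s hds, h₂.1 (s - d) ⟨by linarith, by linarith [hs.2]⟩ _ ht',
        abs_sub_comm, abs_of_nonneg (by linarith)]
      ring
    · rw [hhigh t htd, hlow s hds]
      have hs' : s ∈ Icc 0 (dist x m) := ⟨hs.1, hds⟩
      have e1 := h₁.dist_left hs'
      have e2 := h₁.dist_right hs'
      have e3 := h₂.dist_left ht'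
      have e4 := h₂.dist_right ht'
      apply le_antisymm
      · linarith [dist_triangle (γ₁ s) m (γ₂ (t - d))]
      · linarith [dist_triangle4 x (γ₁ s) (γ₂ (t - d)) y]
  refine ⟨γ, ⟨?_, ?_, ?_⟩, ?_⟩
  · intro s hs t ht
    rcases le_total s t with hst | hst
    · rw [key s hs t ht hst, abs_sub_comm, abs_of_nonneg (sub_nonneg.2 hst)]
    · rw [dist_comm, key t ht s hs hst, abs_of_nonneg (sub_nonneg.2 hst)]
  · rw [hlow 0 hd0, h₁.2.1]
  · rw [hhigh _ (by linarith), ← hxy, add_sub_cancel_left, h₂.2.2]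
  · rw [hlow d le_rfl, h₁.2.2]

/-- Slimness of triangles in terms of metric betweenness. -/
lemma DeltaHyperbolic.exists_btw {δ : ℝ} (hH : DeltaHyperbolic H δ) {x m y : H} (h : Btw x m y)
    (z : H) : ∃ u, dist m u ≤ δ ∧ (Btw x u z ∨ Btw y u z) := by
  obtain ⟨γ₁, h₁, hm⟩ := h.exists_segment hH.1
  obtain ⟨γ₂, h₂⟩ := hH.1 y z
  obtain ⟨γ₃, h₃⟩ := hH.1 z x
  have hxm : dist x m ∈ Icc 0 (dist x y) :=
    ⟨dist_nonneg, by have : _ = _ := h; linarith [dist_nonneg (x := m) (y := y)]⟩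
  obtain ⟨u, hu, hd⟩ := hH.2 x y z γ₁ γ₂ γ₃ h₁ h₂ h₃ _ hxm
  rw [hm] at hd
  rcases hu with ⟨s, hs, rfl⟩ | ⟨s, hs, rfl⟩
  · exact ⟨_, hd, Or.inr (h₂.btw hs)⟩
  · exact ⟨_, hd, Or.inl (h₃.btw hs).symm⟩

/-! ### Convexity in Busemann spaces -/

/-- Two geodesics issued from the same point diverge at least linearly. -/
lemma BusemannSpace.dist_mul_le (hB : BusemannSpace H) {σ τ : ℝ → H} {b b' : ℝ}
    (hσ : IsGeodesicOn σ (Icc 0 b)) (hτ : IsGeodesicOn τ (Icc 0 b')) (h0 : σ 0 = τ 0)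
    {s s' l : ℝ} (hs : s ∈ Icc 0 b) (hs' : s' ∈ Icc 0 b') (hl : l ∈ Icc (0 : ℝ) 1) :
    dist (σ (l * s)) (τ (l * s')) ≤ l * dist (σ s) (τ s') := by
  have hc := (hB.2 0 b 0 b' σ τ hσ hτ).2
    (show ((0 : ℝ), (0 : ℝ)) ∈ _ from ⟨⟨le_rfl, hs.1.trans hs.2⟩, ⟨le_rfl, hs'.1.trans hs'.2⟩⟩)
    (show (s, s') ∈ _ from ⟨hs, hs'⟩) (sub_nonneg.2 hl.2) hl.1 (sub_add_cancel 1 l)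
  simpa [h0] using hc

lemma BusemannSpace.dist_mono (hB : BusemannSpace H) {σ τ : ℝ → H} {b b' : ℝ}
    (hσ : IsGeodesicOn σ (Icc 0 b)) (hτ : IsGeodesicOn τ (Icc 0 b')) (h0 : σ 0 = τ 0)
    {r s : ℝ} (hr : 0 ≤ r) (hrs : r ≤ s) (hs : s ≤ b) (hs' : s ≤ b') :
    dist (σ r) (τ r) ≤ dist (σ s) (τ s) := by
  rcases hr.eq_or_lt with rfl | hr
  · simp [h0]
  have hs0 : 0 < s := hr.trans_le hrs
  have hl : r / s ∈ Icc (0 : ℝ) 1 := ⟨by positivity, (div_le_one hs0).2 hrs⟩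
  have := hB.dist_mul_le hσ hτ h0 (s := s) (s' := s) ⟨hs0.le, hs⟩ ⟨hs0.le, hs'⟩ hl
  rw [div_mul_cancel₀ _ hs0.ne'] at this
  exact this.trans (mul_le_of_le_one_left dist_nonneg hl.2)

/-- Geodesic segments of a Busemann space pass through all points between their ends. -/
lemma BusemannSpace.apply_dist_eq (hB : BusemannSpace H) {σ : ℝ → H} {x m y : H}
    (hσ : IsGeodSegment σ x y) (h : Btw x m y) :
    σ (dist x m) = m := by
  obtain ⟨τ, hτ, hm⟩ := h.exists_segment hB.1
  have hxm : dist x m ≤ dist x y := by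
    have : _ = _ := h
    linarith [dist_nonneg (x := m) (y := y)]
  have := hB.dist_mono hσ.1 hτ.1 (by rw [hσ.2.1, hτ.2.1]) dist_nonneg hxm le_rfl le_rfl
  rw [hσ.2.2, hτ.2.2, dist_self, hm] at this
  exact dist_le_zero.1 this

/-- In a Busemann space, asymptotic rays with the same origin coincide. -/
lemma BusemannSpace.ray_unique (hB : BusemannSpace H) {w : H} {k l : ℝ → H}
    (hk : IsRayFrom w k) (hl : IsRayFrom w l) (hf : FinHausRays k l) {t : ℝ} (ht : 0 ≤ t) :
    k t = l t := by
  obtain ⟨C, hC, -⟩ := hf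
  have hkd : ∀ s, 0 ≤ s → dist w (k s) = s := fun s hs => by
    have := hk.1 0 self_mem_Ici s hs
    rwa [hk.2, zero_sub, abs_neg, abs_of_nonneg hs] at this
  have hld : ∀ s, 0 ≤ s → dist w (l s) = s := fun s hs => by
    have := hl.1 0 self_mem_Ici s hs
    rwa [hl.2, zero_sub, abs_neg, abs_of_nonneg hs] at this
  have hbd : ∀ s, 0 ≤ s → dist (k s) (l s) ≤ 2 * C := by
    intro s hs
    obtain ⟨u, hu, hsu⟩ := hC s hs
    have h1 := hl.1 u hu s hs
    have h2 : |u - s| ≤ C := by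
      rw [abs_le]
      constructor
      · linarith [dist_triangle w (l u) (k s), dist_comm (l u) (k s), hkd s hs, hld u hu]
      · linarith [dist_triangle w (k s) (l u), hkd s hs, hld u hu]
    linarith [dist_triangle (k s) (l u) (l s)]
  have hle : ∀ n : ℕ, dist (k t) (l t) ≤ 2 * C * (1 / ((n : ℝ) + 1)) := by
    intro n
    have hn : (0 : ℝ) < (n : ℝ) + 1 := by positivity
    have hT : 0 ≤ ((n : ℝ) + 1) * t := by positivity
    have := hB.dist_mul_le (hk.1.mono Icc_subset_Ici_self) (hl.1.mono Icc_subset_Ici_self)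
      (hk.2.trans hl.2.symm) (b := (n + 1) * t) (b' := (n + 1) * t)
      (s := (n + 1) * t) (s' := (n + 1) * t) (l := 1 / ((n : ℝ) + 1)) ⟨hT, le_rfl⟩ ⟨hT, le_rfl⟩
      ⟨by positivity, by rw [div_le_one hn]; linarith [n.cast_nonneg (α := ℝ)]⟩
    rw [one_div, inv_mul_cancel_left₀ hn.ne'] at this
    rw [one_div, mul_comm]
    exact this.trans (by gcongr; exact hbd _ hT)
  have hlim : Tendsto (fun n : ℕ => 2 * C * (1 / ((n : ℝ) + 1))) atTop (nhds 0) := by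
    simpa using tendsto_one_div_add_atTop_nhds_zero_nat.const_mul (2 * C)
  exact dist_le_zero.1 (ge_of_tendsto' hlim hle)

/-! ### The height function -/

section Height

variable {w : H} {a : ℝ → H}

lemma monotone_sub_dist_ray (ha : IsRayFrom w a) (x : H) :
    Monotone fun t : ℝ => max t 0 - dist x (a (max t 0)) := by
  intro s t hst
  have h0 : max s 0 ≤ max t 0 := max_le_max_right 0 hst
  have h1 := ha.1 (max s 0) (mem_Ici.2 (le_max_right _ _)) (max t 0) (mem_Ici.2 (le_max_right _ _))
  rw [abs_sub_comm, abs_of_nonneg (sub_nonneg.2 h0)] at h1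
  have := dist_triangle x (a (max s 0)) (a (max t 0))
  simp only
  linarith

lemma exists_tendsto_dist_ray (ha : IsRayFrom w a) (x : H) :
    ∃ c, Tendsto (fun t : ℝ => t - dist x (a t)) atTop (nhds c) ∧
      ∀ t, 0 ≤ t → t - dist x (a t) ≤ c := by
  have hmono := monotone_sub_dist_ray ha x
  have hbdd : BddAbove (range fun t : ℝ => max t 0 - dist x (a (max t 0))) := by
    refine ⟨dist w x, ?_⟩
    rintro _ ⟨t, rfl⟩
    have h1 := ha.1 0 self_mem_Ici (max t 0) (mem_Ici.2 (le_max_right _ _))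
    rw [ha.2, zero_sub, abs_neg, abs_of_nonneg (le_max_right _ _)] at h1
    have := dist_triangle w x (a (max t 0))
    simp only
    linarith
  have hlim := tendsto_atTop_ciSup hmono hbdd
  refine ⟨_, hlim.congr' ?_, fun t ht => ?_⟩
  · filter_upwards [eventually_ge_atTop 0] with t ht
    rw [max_eq_left ht]
  · have := hmono.ge_of_tendsto hlim t
    rwa [max_eq_left ht] at this

lemma BusemannSpace.busemann_eq (hB : BusemannSpace H) (ha : IsRayFrom w a) {x : H} {c : ℝ}
    (hc : Tendsto (fun t : ℝ => t - dist x (a t)) atTop (nhds c)) : busemann w a x = -c := by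
  have hlim : ∀ k : ℝ → H, (∀ t, 0 ≤ t → k t = a t) →
      limsup (fun t => dist x (k t) - t) atTop = -c := by
    intro k hk
    refine Tendsto.limsup_eq (hc.neg.congr' ?_)
    filter_upwards [eventually_ge_atTop 0] with t ht
    rw [hk t ht]; ring
  have hset : {b : ℝ | ∃ k : ℝ → H, IsRayFrom w k ∧ FinHausRays a k ∧
      b = limsup (fun t => dist x (k t) - t) atTop} = {-c} := by
    ext b
    simp only [mem_ofPred_eq, mem_singleton_iff]
    constructor
    · rintro ⟨k, hk, hf, rfl⟩
      exact hlim k fun t ht => (hB.ray_unique ha hk hf ht).symm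
    · rintro rfl
      exact ⟨a, ha, ⟨0, fun s hs => ⟨s, hs, by simp⟩, fun s hs => ⟨s, hs, by simp⟩⟩,
        (hlim a fun _ _ => rfl).symm⟩
  rw [busemann, hset, csSup_singleton]

lemma BusemannSpace.tendsto_height (hB : BusemannSpace H) (ha : IsRayFrom w a) (x : H) :
    Tendsto (fun t : ℝ => t - dist x (a t)) atTop (nhds (height w a x)) := by
  obtain ⟨c, hc, -⟩ := exists_tendsto_dist_ray ha x
  rwa [height, hB.busemann_eq ha hc, neg_neg]

lemma BusemannSpace.le_height (hB : BusemannSpace H) (ha : IsRayFrom w a) (x : H) {t : ℝ}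
    (ht : 0 ≤ t) : t - dist x (a t) ≤ height w a x := by
  obtain ⟨c, hc, hle⟩ := exists_tendsto_dist_ray ha x
  rw [height, hB.busemann_eq ha hc, neg_neg]
  exact hle t ht

lemma BusemannSpace.height_sub_le (hB : BusemannSpace H) (ha : IsRayFrom w a) (x y : H) :
    height w a x - height w a y ≤ dist x y := by
  have := ((hB.tendsto_height ha x).sub (hB.tendsto_height ha y))
  refine le_of_tendsto' this fun t => ?_
  linarith [dist_triangle y x (a t), dist_comm x y]

end Height

/-! ### Thin triangles -/

/-- A point almost between `P` and `x` is close to any geodesic segment from `P` to `x`. -/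
lemma DeltaHyperbolic.exists_near_of_almost_btw {δ : ℝ} (hδ : 0 ≤ δ) (hH : DeltaHyperbolic H δ)
    {P x z : H} {σ : ℝ → H} (hσ : IsGeodSegment σ P x)
    (hz : dist x z + dist z P ≤ dist x P + δ) :
    ∃ r ∈ Icc 0 (dist P x), dist (σ r) z ≤ 3 * δ := by
  have c1 := dist_comm P x
  have c2 := dist_comm P z
  have hr : min (dist P z) (dist P x) ∈ Icc 0 (dist P x) :=
    ⟨le_min dist_nonneg dist_nonneg, min_le_right _ _⟩
  have hr' : dist P z - δ ≤ min (dist P z) (dist P x) :=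
    le_min (by linarith) (by linarith [dist_nonneg (x := x) (y := z)])
  have hr'' := min_le_left (dist P z) (dist P x)
  refine ⟨_, hr, ?_⟩
  have e1 := hσ.dist_left hr
  have e2 := hσ.dist_right hr
  set r := min (dist P z) (dist P x)
  obtain ⟨u, hu, h | h⟩ := hH.exists_btw (hσ.btw hr) z
  · have h : _ = _ := h
    linarith [dist_triangle (σ r) u z, dist_triangle P u (σ r), dist_comm u (σ r)]
  · have h : _ = _ := h
    linarith [dist_triangle (σ r) u z, dist_triangle x u (σ r), dist_comm u (σ r),
      dist_comm x (σ r)]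

/-- Every geodesic side of a slim triangle has a point close to both other sides. -/
lemma DeltaHyperbolic.exists_center [ProperSpace H] {δ : ℝ} (hH : DeltaHyperbolic H δ)
    (x y z : H) : ∃ m p q : H, Btw x m y ∧ Btw z p x ∧ Btw z q y ∧ dist m p ≤ δ ∧
      dist m q ≤ δ := by
  obtain ⟨τ, hτ⟩ := hH.1 x y
  have hclosed : ∀ v : H, IsClosed {u | Btw z u v} := fun v =>
    isClosed_eq (by fun_prop) continuous_const
  have hmem : ∀ v : H, v ∈ {u | Btw z u v} := fun v => by simp [Btw]
  have hcont : ∀ v : H, ContinuousOn (fun s => Metric.infDist (τ s) {u | Btw z u v})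
      (Icc 0 (dist x y)) := fun v =>
    (Metric.continuous_infDist_pt _).comp_continuousOn hτ.1.continuousOn
  obtain ⟨s, hs, hs0⟩ := intermediate_value_Icc dist_nonneg ((hcont x).sub (hcont y))
    (show (0 : ℝ) ∈ _ by
      simp only [Pi.sub_apply, mem_Icc]
      rw [hτ.2.1, hτ.2.2, Metric.infDist_zero_of_mem (hmem x), Metric.infDist_zero_of_mem (hmem y)]
      constructor <;> linarith [Metric.infDist_nonneg (x := x) (s := {u | Btw z u y}),
        Metric.infDist_nonneg (x := y) (s := {u | Btw z u x})])
  have heq : Metric.infDist (τ s) {u | Btw z u x} = Metric.infDist (τ s) {u | Btw z u y} :=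
    sub_eq_zero.1 hs0
  have hle : Metric.infDist (τ s) {u | Btw z u x} ≤ δ := by
    obtain ⟨u, hu, h | h⟩ := hH.exists_btw (hτ.btw hs) z
    · exact (Metric.infDist_le_dist_of_mem (s := {u | Btw z u _}) h.symm).trans hu
    · rw [heq]
      exact (Metric.infDist_le_dist_of_mem (s := {u | Btw z u _}) h.symm).trans hu
  obtain ⟨p, hp, hpd⟩ := (hclosed x).exists_infDist_eq_dist ⟨_, hmem x⟩ (τ s)
  obtain ⟨q, hq, hqd⟩ := (hclosed y).exists_infDist_eq_dist ⟨_, hmem y⟩ (τ s)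
  exact ⟨τ s, p, q, hτ.btw hs, hp, hq, hpd ▸ hle, hqd ▸ heq ▸ hle⟩

/-- If `x₀` and `y₀` are far apart, at almost the same distance from `P`, and almost on geodesics
from `x` and `y` to `P`, then a geodesic from `x` to `y` passes near the center of the triangle
`x₀ y₀ P`. -/
lemma exists_btw_dist_le [ProperSpace H] {δ : ℝ} (hδ : 0 < δ) (hH : DeltaHyperbolic H δ)
    (hB : BusemannSpace H) {P x y x₀ y₀ : H}
    (hx : dist x x₀ + dist x₀ P ≤ dist x P + δ) (hy : dist y y₀ + dist y₀ P ≤ dist y P + δ)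
    (hP : |dist x₀ P - dist y₀ P| ≤ δ) (hfar : 17 * δ < dist x₀ y₀) :
    ∃ m, Btw x m y ∧ dist m P ≤ dist x₀ P - dist x₀ y₀ / 2 + 25 / 2 * δ := by
  obtain ⟨σ, hσ⟩ := hH.1 P x
  obtain ⟨τ, hτ⟩ := hH.1 P y
  obtain ⟨u, hu, hud⟩ := hH.exists_near_of_almost_btw hδ.le hσ hx
  obtain ⟨v, hv, hvd⟩ := hH.exists_near_of_almost_btw hδ.le hτ hy
  obtain ⟨m, p, q, hm, hp, hq, hmp, hmq⟩ := hH.exists_center x y P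
  have e0 : σ 0 = τ 0 := by rw [hσ.2.1, hτ.2.1]
  have ep := hB.apply_dist_eq hσ hp
  have eq := hB.apply_dist_eq hτ hq
  have hs1 : dist P p ≤ dist P x := by
    have : _ = _ := hp
    linarith [dist_nonneg (x := p) (y := x)]
  have hs2 : dist P q ≤ dist P y := by
    have : _ = _ := hq
    linarith [dist_nonneg (x := q) (y := y)]
  have hs10 : 0 ≤ dist P p := dist_nonneg
  have hs20 : 0 ≤ dist P q := dist_nonneg
  have hPu := hσ.dist_left hu
  have hPv := hτ.dist_left hv
  have hs12 : |dist P p - dist P q| ≤ 2 * δ := by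
    rw [abs_le]
    constructor <;> linarith [dist_triangle P p q, dist_triangle P q p, dist_comm p q,
      dist_triangle_left p q m]
  have hux : |u - dist x₀ P| ≤ 3 * δ := by
    rw [abs_le]
    constructor <;> linarith [dist_triangle P (σ u) x₀, dist_triangle P x₀ (σ u),
      dist_comm x₀ (σ u), dist_comm P x₀]
  have hvy : |v - dist y₀ P| ≤ 3 * δ := by
    rw [abs_le]
    constructor <;> linarith [dist_triangle P (τ v) y₀, dist_triangle P y₀ (τ v),
      dist_comm y₀ (τ v), dist_comm P y₀]
  have hpm : dist P m ≤ dist P p + δ := by linarith [dist_triangle P p m, dist_comm p m]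
  have hqm : dist P m ≤ dist P q + δ := by linarith [dist_triangle P q m, dist_comm q m]
  have hpq : dist (σ (dist P p)) (τ (dist P q)) ≤ 2 * δ := by
    rw [ep, eq]; linarith [dist_triangle_left p q m]
  have huv : dist x₀ y₀ - 6 * δ ≤ dist (σ u) (τ v) := by
    linarith [dist_triangle4 x₀ (σ u) (τ v) y₀, dist_comm x₀ (σ u)]
  rw [abs_le] at hs12 hux hvy hP
  have min_cases : ∀ b b' : ℝ, b ∈ Icc 0 (dist P x) → b' ∈ Icc 0 (dist P y) →
      dist (σ (min b b')) (τ (min b b')) ≤ dist (σ b) (τ b') + |b - b'| ∧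
      dist (σ b) (τ b') ≤ dist (σ (min b b')) (τ (min b b')) + |b - b'| := by
    intro b b' hb hb'
    rcases le_total b b' with h | h
    · rw [min_eq_left h]
      have := hτ.1 b ⟨hb.1, h.trans hb'.2⟩ b' hb'
      constructor <;> linarith [dist_triangle (σ b) (τ b) (τ b'),
        dist_triangle (σ b) (τ b') (τ b), dist_comm (τ b) (τ b')]
    · rw [min_eq_right h]
      have := hσ.1 b hb b' ⟨hb'.1, h.trans hb.2⟩
      constructor <;> linarith [dist_triangle (σ b) (σ b') (τ b'),
        dist_triangle (σ b') (σ b) (τ b'), dist_comm (σ b) (σ b')]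
  have hS := (min_cases _ _ ⟨hs10, hs1⟩ ⟨hs20, hs2⟩).1
  have hR := (min_cases _ _ hu hv).2
  have hSd : |dist P p - dist P q| ≤ 2 * δ := abs_le.2 ⟨by linarith, by linarith⟩
  have hRd : |u - v| ≤ 7 * δ := abs_le.2 ⟨by linarith, by linarith⟩
  have hSx : min (dist P p) (dist P q) ≤ dist P x := (min_le_left _ _).trans hs1
  have hSy : min (dist P p) (dist P q) ≤ dist P y := (min_le_right _ _).trans hs2
  have hS0 : 0 ≤ min (dist P p) (dist P q) := le_min hs10 hs20
  have hRx : min u v ≤ dist P x := (min_le_left _ _).trans hu.2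
  have hRy : min u v ≤ dist P y := (min_le_right _ _).trans hv.2
  have hR0 : 0 ≤ min u v := le_min hu.1 hv.1
  have hRu : min u v ≤ u := min_le_left _ _
  have hmS : dist P m - δ ≤ min (dist P p) (dist P q) := le_min (by linarith) (by linarith)
  refine ⟨m, hm, ?_⟩
  rw [dist_comm m P]
  generalize min (dist P p) (dist P q) = s at *
  generalize min u v = r at *
  rcases le_total r s with hrs | hsr
  · have := hB.dist_mono hσ.1 hτ.1 e0 hR0 hrs hSx hSy
    linarith
  · have h1 := hσ.1 r ⟨hR0, hRx⟩ s ⟨hS0, hSx⟩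
    have h2 := hτ.1 s ⟨hS0, hSy⟩ r ⟨hR0, hRy⟩
    rw [abs_of_nonneg (by linarith)] at h1
    rw [abs_sub_comm, abs_of_nonneg (by linarith)] at h2
    linarith [dist_triangle4 (σ r) (σ s) (τ s) (τ r)]

/-- The geodesic between two points passes far above the horosphere at which the vertical geodesics
through these points are far apart. -/
lemma exists_btw_height_ge [ProperSpace H] {δ : ℝ} (hδ : 0 < δ) (hH : DeltaHyperbolic H δ)
    (hB : BusemannSpace H) {w : H} {a : ℝ → H} (ha : IsRayFrom w a) {x y x₀ y₀ : H} {t₀ : ℝ}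
    (hx₀ : height w a x₀ = t₀) (hy₀ : height w a y₀ = t₀)
    (hx : dist x x₀ = t₀ - height w a x) (hy : dist y y₀ = t₀ - height w a y)
    (hfar : 17 * δ < dist x₀ y₀) :
    ∃ m, Btw x m y ∧ t₀ + dist x₀ y₀ / 2 - 14 * δ ≤ height w a m := by
  have hev : ∀ z : H, ∀ᶠ t in atTop, height w a z - δ < t - dist z (a t) := fun z =>
    (hB.tendsto_height ha z).eventually_const_lt (by linarith)
  obtain ⟨t, h1, h2, ht⟩ := ((hev x₀).and ((hev y₀).and (eventually_ge_atTop 0))).exists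
  have k1 := hB.le_height ha x ht
  have k2 := hB.le_height ha y ht
  have k3 := hB.le_height ha x₀ ht
  have k4 := hB.le_height ha y₀ ht
  obtain ⟨m, hm, hd⟩ := exists_btw_dist_le hδ hH hB (P := a t) (x := x) (y := y) (x₀ := x₀)
    (y₀ := y₀) (by linarith) (by linarith) (abs_le.2 ⟨by linarith, by linarith⟩) hfar
  exact ⟨m, hm, by linarith [hB.le_height ha m ht]⟩

/-! ### Exponential divergence -/

/-- A continuous path can be cut into two pieces each having at most half of a given bound on the
length. -/
lemma exists_halving {E : Type*} [PseudoEMetricSpace E] {γ : ℝ → E} (hγ : Continuous γ) {s t : ℝ}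
    (hst : s ≤ t) {c : ℝ≥0∞} (hc : eVariationOn γ (Icc s t) ≤ c + c) :
    ∃ r ∈ Icc s t, eVariationOn γ (Icc s r) ≤ c ∧ eVariationOn γ (Icc r t) ≤ c := by
  let F : ℝ → ℝ≥0∞ := fun r => eVariationOn (γ ∘ fun u => min u r) (Icc s t)
  let G : ℝ → ℝ≥0∞ := fun r => eVariationOn (γ ∘ fun u => max u r) (Icc s t)
  have hF : ∀ r ∈ Icc s t, F r = eVariationOn γ (Icc s r) := by
    intro r hr
    have himg : (fun u => min u r) '' Icc s t = Icc s r := by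
      ext v
      constructor
      · rintro ⟨u, hu, rfl⟩
        exact ⟨le_min hu.1 hr.1, min_le_right _ _⟩
      · rintro ⟨h1, h2⟩
        exact ⟨v, ⟨h1, h2.trans hr.2⟩, min_eq_left h2⟩
    rw [← himg]
    exact eVariationOn.comp_eq_of_monotoneOn γ _ fun _ _ _ _ h => min_le_min_right r h
  have hG : ∀ r ∈ Icc s t, G r = eVariationOn γ (Icc r t) := by
    intro r hr
    have himg : (fun u => max u r) '' Icc s t = Icc r t := by
      ext v
      constructor
      · rintro ⟨u, hu, rfl⟩
        exact ⟨le_max_right _ _, max_le hu.2 hr.2⟩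
      · rintro ⟨h1, h2⟩
        exact ⟨v, ⟨hr.1.trans h1, h2⟩, max_eq_left h1⟩
    rw [← himg]
    exact eVariationOn.comp_eq_of_monotoneOn γ _ fun _ _ _ _ h => max_le_max_right r h
  have hFc : LowerSemicontinuous F := fun r v hv =>
    eVariationOn.lowerSemicontinuous_aux
      (fun u _ => (show Continuous fun r => γ (min u r) by fun_prop).tendsto r) hv
  have hGc : LowerSemicontinuous G := fun r v hv =>
    eVariationOn.lowerSemicontinuous_aux
      (fun u _ => (show Continuous fun r => γ (max u r) by fun_prop).tendsto r) hv
  obtain ⟨r, hr, h1, h2⟩ := isPreconnected_closed_iff.1 (isPreconnected_Icc (a := s) (b := t))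
    (F ⁻¹' Iic c) (G ⁻¹' Iic c) (hFc.isClosed_preimage c) (hGc.isClosed_preimage c)
    (by
      intro r hr
      by_contra h
      simp only [mem_union, mem_preimage, mem_Iic, not_or, not_le] at h
      have hadd := eVariationOn.Icc_add_Icc γ (s := univ) hr.1 hr.2 (mem_univ r)
      simp only [univ_inter] at hadd
      rw [← hadd, ← hF r hr, ← hG r hr] at hc
      exact absurd hc (not_le.2 (ENNReal.add_lt_add h.1 h.2)))
    ⟨s, ⟨le_rfl, hst⟩, by
      rw [mem_preimage, hF s ⟨le_rfl, hst⟩, mem_Iic, Icc_self,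
        eVariationOn.subsingleton γ subsingleton_singleton]
      exact zero_le⟩
    ⟨t, ⟨hst, le_rfl⟩, by
      rw [mem_preimage, hG t ⟨hst, le_rfl⟩, mem_Iic, Icc_self,
        eVariationOn.subsingleton γ subsingleton_singleton]
      exact zero_le⟩
  exact ⟨r, hr, by rwa [← hF r hr], by rwa [← hG r hr]⟩

/-- A geodesic stays logarithmically close to every path with the same ends. -/
lemma DeltaHyperbolic.exists_dist_le_of_variation_le {δ : ℝ} (hH : DeltaHyperbolic H δ)
    {γ : ℝ → H} (hγ : Continuous γ) {ℓ : ℝ} (hℓ : 0 ≤ ℓ) (N : ℕ) {s t : ℝ} (hst : s ≤ t)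
    (hv : eVariationOn γ (Icc s t) ≤ ENNReal.ofReal (2 ^ N * ℓ)) {m : H}
    (hm : Btw (γ s) m (γ t)) : ∃ r ∈ Icc s t, dist m (γ r) ≤ N * δ + ℓ := by
  induction N generalizing s t m with
  | zero =>
    refine ⟨s, ⟨le_rfl, hst⟩, ?_⟩
    have h1 := (eVariationOn.edist_le γ (left_mem_Icc.2 hst) (right_mem_Icc.2 hst)).trans hv
    rw [edist_dist, ENNReal.ofReal_le_ofReal_iff (by positivity)] at h1
    have h2 : _ = _ := hm
    rw [dist_comm]
    simp only [pow_zero, one_mul, Nat.cast_zero, zero_mul, zero_add] at h1 ⊢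
    linarith [dist_nonneg (x := m) (y := γ t)]
  | succ N ih =>
    have hsplit : ENNReal.ofReal (2 ^ (N + 1) * ℓ) =
        ENNReal.ofReal (2 ^ N * ℓ) + ENNReal.ofReal (2 ^ N * ℓ) := by
      rw [← ENNReal.ofReal_add (by positivity) (by positivity)]
      congr 1; ring
    rw [hsplit] at hv
    obtain ⟨r, hr, h1, h2⟩ := exists_halving hγ hst hv
    obtain ⟨u, hu, h | h⟩ := hH.exists_btw hm (γ r)
    · obtain ⟨q, hq, hd⟩ := ih hr.1 h1 h
      refine ⟨q, ⟨hq.1, hq.2.trans hr.2⟩, ?_⟩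
      push_cast
      linarith [dist_triangle m u (γ q)]
    · obtain ⟨q, hq, hd⟩ := ih hr.2 h2 h.symm
      refine ⟨q, ⟨hr.1.trans hq.1, hq.2⟩, ?_⟩
      push_cast
      linarith [dist_triangle m u (γ q)]

/-- A path joining the ends of a geodesic and avoiding a ball of large radius around one of its
points is exponentially long. -/
lemma DeltaHyperbolic.two_rpow_le_variation {δ : ℝ} (hδ : 1 ≤ δ) (hH : DeltaHyperbolic H δ)
    {γ : ℝ → H} (hγ : Continuous γ) {s t : ℝ} (hst : s ≤ t) {m : H} (hm : Btw (γ s) m (γ t))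
    {R : ℝ} (hRδ : δ < R) (hR : ∀ r ∈ Icc s t, R ≤ dist m (γ r)) :
    ENNReal.ofReal (2 ^ (R / δ - 2)) ≤ eVariationOn γ (Icc s t) := by
  by_contra! hlt
  have hδ0 : 0 < δ := by linarith
  set N := ⌈R / δ - 2⌉₊ with hN
  have hle : (2 : ℝ) ^ (R / δ - 2) ≤ 2 ^ N * δ := by
    calc (2 : ℝ) ^ (R / δ - 2) ≤ 2 ^ (N : ℝ) :=
          Real.rpow_le_rpow_of_exponent_le one_le_two (Nat.le_ceil _)
      _ = 2 ^ N := Real.rpow_natCast _ _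
      _ ≤ 2 ^ N * δ := le_mul_of_one_le_right (by positivity) hδ
  obtain ⟨r, hr, hd⟩ := hH.exists_dist_le_of_variation_le hγ hδ0.le N hst
    (hlt.le.trans (ENNReal.ofReal_le_ofReal hle)) hm
  have hNlt : (N : ℝ) < R / δ - 1 := by
    rcases le_or_gt (R / δ - 2) 0 with h | h
    · rw [hN, Nat.ceil_eq_zero.2 h, Nat.cast_zero, sub_pos]
      exact (one_lt_div hδ0).2 hRδ
    · linarith [Nat.ceil_lt_add_one h.le]
  have : N * δ < (R / δ - 1) * δ := mul_lt_mul_of_pos_right hNlt hδ0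
  rw [sub_mul, div_mul_cancel₀ _ hδ0.ne'] at this
  linarith [hR r hr]

/-- The length of a path joining two points and avoiding a large ball centered on the geodesic
between them, away from two balls centered at its ends. -/
lemma DeltaHyperbolic.add_add_two_rpow_le_variation {δ : ℝ} (hδ : 1 ≤ δ)
    (hH : DeltaHyperbolic H δ) {γ : ℝ → H} (hγ : Continuous γ) {T : ℝ} (hT : 0 ≤ T) {m : H}
    (hm : Btw (γ 0) m (γ T)) {A B R : ℝ} (hA : 0 ≤ A) (hB : 0 ≤ B) (hRδ : 3 * δ < R)
    (hAm : A + R ≤ dist (γ 0) m) (hBm : B + R ≤ dist (γ T) m)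
    (hR : ∀ r ∈ Icc 0 T, R ≤ dist m (γ r)) :
    ENNReal.ofReal (A + B + 2 ^ (R / δ - 4)) ≤ eVariationOn γ (Icc 0 T) := by
  have hδ0 : 0 < δ := by linarith
  have hm' : _ = _ := hm
  have c1 := dist_comm m (γ T)
  have hcA : Continuous fun r => dist (γ 0) (γ r) := by fun_prop
  have hcB : Continuous fun r => dist (γ T) (γ r) := by fun_prop
  obtain ⟨p, hp, hpA⟩ : ∃ p ∈ Icc 0 T, dist (γ 0) (γ p) = A :=
    intermediate_value_Icc hT hcA.continuousOn
      ⟨by simpa using hA, by linarith [dist_nonneg (x := m) (y := γ T)]⟩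
  obtain ⟨q, hq, hqB⟩ : ∃ q ∈ Icc p T, dist (γ T) (γ q) = B :=
    intermediate_value_Icc' hp.2 hcB.continuousOn
      ⟨by simpa using hB, by
        linarith [dist_triangle (γ 0) (γ p) (γ T), dist_comm (γ p) (γ T)]⟩
  have hq0 : q ∈ Icc 0 T := ⟨hp.1.trans hq.1, hq.2⟩
  obtain ⟨m₁, hm₁, h | h⟩ := hH.exists_btw hm (γ p)
  · have h : _ = _ := h
    linarith [dist_triangle (γ 0) m₁ m, dist_comm m₁ m, dist_nonneg (x := m₁) (y := γ p)]
  obtain ⟨m₂, hm₂, h' | h'⟩ := hH.exists_btw h (γ q)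
  · have h' : _ = _ := h'
    linarith [dist_triangle4 (γ T) m₂ m₁ m, dist_comm m₁ m, dist_comm m₂ m₁,
      dist_nonneg (x := m₂) (y := γ q)]
  have hmid := hH.two_rpow_le_variation hδ hγ hq.1 h' (R := R - 2 * δ) (by linarith)
    fun r hr => by
      have := hR r ⟨hp.1.trans hr.1, hr.2.trans hq.2⟩
      linarith [dist_triangle4 m m₁ m₂ (γ r)]
  have hexp : (R - 2 * δ) / δ - 2 = R / δ - 4 := by
    field_simp
    ring
  rw [hexp] at hmid
  have hfst := eVariationOn.edist_le γ (left_mem_Icc.2 hp.1) (right_mem_Icc.2 hp.1)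
  have hlst := eVariationOn.edist_le γ (right_mem_Icc.2 hq.2) (left_mem_Icc.2 hq.2)
  rw [edist_dist, hpA] at hfst
  rw [edist_dist, hqB] at hlst
  have hadd1 := eVariationOn.Icc_add_Icc γ (s := univ) hp.1 hp.2 (mem_univ p)
  have hadd2 := eVariationOn.Icc_add_Icc γ (s := univ) hq.1 hq.2 (mem_univ q)
  simp only [univ_inter] at hadd1 hadd2
  rw [← hadd1, ← hadd2, add_assoc, add_comm B, ENNReal.ofReal_add hA (by positivity),
    ENNReal.ofReal_add (by positivity) hB]
  gcongr

/-- Exponential lower bound on the length of a path joining `x` to `y`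
which stays below the horosphere through `x₀ = V_x(t₀)`. -/
theorem statement5 {H : Type*} [MetricSpace H] [ProperSpace H]
    (δ : ℝ) (hδ : 1 ≤ δ) (hH : DeltaHyperbolic H δ) (hB : BusemannSpace H)
    (w : H) (a : ℝ → H) (ha : IsRayFrom w a)
    (x y : H)
    (Vx : ℝ → H) (hVx : VertParam w a Vx) (hVxx : Vx (height w a x) = x)
    (Vy : ℝ → H) (hVy : VertParam w a Vy) (hVyy : Vy (height w a y) = y)
    (t₀ : ℝ) (ht₀ : max (height w a x) (height w a y) ≤ t₀)
    (hfar : 768 * δ < dist (Vx t₀) (Vy t₀))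
    (T : ℝ) (hT : 0 ≤ T) (γ : ℝ → H) (hγc : ContinuousOn γ (Set.Icc 0 T))
    (hγ0 : γ 0 = x) (hγT : γ T = y)
    (hbelow : ∀ t ∈ Set.Icc (0:ℝ) T, height w a (γ t) ≤ height w a (Vx t₀)) :
    ENNReal.ofReal (dh w a x (Vx t₀) + dh w a y (Vy t₀)
        + 2 ^ (-(386:ℝ)) * 2 ^ (dist (Vx t₀) (Vy t₀) / (2*δ)) - 24 * δ)
      ≤ eVariationOn γ (Set.Icc 0 T) := by
  have hδ0 : 0 < δ := by linarith
  obtain ⟨hx, hy⟩ := max_le_iff.1 ht₀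
  have hdx : dist x (Vx t₀) = t₀ - height w a x := by
    have := hVx.1 (height w a x) (mem_univ _) t₀ (mem_univ _)
    rwa [hVxx, abs_sub_comm, abs_of_nonneg (sub_nonneg.2 hx)] at this
  have hdy : dist y (Vy t₀) = t₀ - height w a y := by
    have := hVy.1 (height w a y) (mem_univ _) t₀ (mem_univ _)
    rwa [hVyy, abs_sub_comm, abs_of_nonneg (sub_nonneg.2 hy)] at this
  rw [hVx.2 t₀] at hbelow
  rw [dh, dh, hVx.2 t₀, hVy.2 t₀, abs_sub_comm, abs_of_nonneg (sub_nonneg.2 hx),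
    abs_sub_comm (height w a y), abs_of_nonneg (sub_nonneg.2 hy)]
  obtain ⟨m, hm, hmh⟩ := exists_btw_height_ge hδ0 hH hB ha (hVx.2 t₀) (hVy.2 t₀) hdx hdy
    (by linarith)
  set D := dist (Vx t₀) (Vy t₀)
  let γ' : ℝ → H := IccExtend hT ((Icc 0 T).domRestrict γ)
  have hγ' : Continuous γ' := hγc.domRestrict.Icc_extend'
  have heq : EqOn γ' γ (Icc 0 T) := fun r hr => IccExtend_of_mem hT _ hr
  have h0 : γ' 0 = x := (heq (left_mem_Icc.2 hT)).trans hγ0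
  have hT' : γ' T = y := (heq (right_mem_Icc.2 hT)).trans hγT
  rw [← eVariationOn.congr heq]
  refine le_trans (ENNReal.ofReal_le_ofReal ?_)
    (hH.add_add_two_rpow_le_variation hδ hγ' hT (m := m) (by rwa [h0, hT'])
      (sub_nonneg.2 hx) (sub_nonneg.2 hy) (R := D / 2 - 14 * δ) (by linarith) ?_ ?_ ?_)
  · have hexp : (2 : ℝ) ^ (-(386 : ℝ)) * 2 ^ (D / (2 * δ)) ≤ 2 ^ ((D / 2 - 14 * δ) / δ - 4) := by
      rw [← Real.rpow_add two_pos]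
      refine Real.rpow_le_rpow_of_exponent_le one_le_two ?_
      have : (D / 2 - 14 * δ) / δ - 4 = -18 + D / (2 * δ) := by
        field_simp
        ring
      rw [this]
      linarith
    linarith
  · rw [h0]
    linarith [hB.height_sub_le ha m x, dist_comm x m]
  · rw [hT']
    linarith [hB.height_sub_le ha m y, dist_comm y m]
  · intro r hr
    rw [heq hr]
    linarith [hB.height_sub_le ha m (γ r), hbelow r hr]

end HP

end
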